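/- The A-module M := A ⊕ D(A) is a 2-cluster tilting module, i.e. add(M) = {X ∈ mod-A : Ext¹_A(M,X) = 0} = {X ∈ mod-A : Ext¹_A(X,M) = 0}. -/

import Mathlib

/-!
We formalize statements about the algebra `A = kQ/J²`, where `Q` is the quiver
`1 ⇄ 2 ⇄ 3` and `J` is the arrow ideal of the path algebra `kQ`.
The algebra `A` is presented by generators and relations as a quotient of the
free algebra on three vertex idempotents and four arrows.
Right `A`-modules are treated as left modules over `Aᵐᵒᵖ`.
-/

open CategoryTheory Opposite

/-- Generators of the path algebra `kQ`: three vertex idempotents `e i`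
and four arrows `ar a`, where the arrows of `Q` are
`α : 1 → 2`, `β : 2 → 1`, `γ : 2 → 3`, `δ : 3 → 2`. -/
inductive QGen : Type
  | e : Fin 3 → QGen
  | ar : Fin 4 → QGen

/-- The sources of the four arrows `α, β, γ, δ` (vertices `1,2,3` are `0,1,2 : Fin 3`). -/
def arrowSrc : Fin 4 → Fin 3 := ![0, 1, 1, 2]

/-- The targets of the four arrows `α, β, γ, δ`. -/
def arrowTgt : Fin 4 → Fin 3 := ![1, 0, 2, 1]

/-- The defining relations of `A = kQ/J²`: the `e i` are orthogonal idempotents summing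
to `1`, the arrows are compatible with their sources and targets, and any product of
two arrows vanishes (`J² = 0`). -/
inductive ARel (k : Type) [Field k] : FreeAlgebra k QGen → FreeAlgebra k QGen → Prop
  | idem (i j : Fin 3) :
      ARel k (FreeAlgebra.ι k (QGen.e i) * FreeAlgebra.ι k (QGen.e j))
        (if i = j then FreeAlgebra.ι k (QGen.e i) else 0)
  | sum : ARel k
      (FreeAlgebra.ι k (QGen.e 0) + FreeAlgebra.ι k (QGen.e 1) + FreeAlgebra.ι k (QGen.e 2)) 1
  | src (a : Fin 4) :
      ARel k (FreeAlgebra.ι k (QGen.e (arrowSrc a)) * FreeAlgebra.ι k (QGen.ar a))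
        (FreeAlgebra.ι k (QGen.ar a))
  | tgt (a : Fin 4) :
      ARel k (FreeAlgebra.ι k (QGen.ar a) * FreeAlgebra.ι k (QGen.e (arrowTgt a)))
        (FreeAlgebra.ι k (QGen.ar a))
  | radsq (a b : Fin 4) :
      ARel k (FreeAlgebra.ι k (QGen.ar a) * FreeAlgebra.ι k (QGen.ar b)) 0

/-- The algebra `A = kQ/J²`. -/
abbrev AlgA (k : Type) [Field k] : Type := RingQuot (ARel k)

/-- Right `A`-modules are left modules over `Aop k = Aᵐᵒᵖ`. -/
abbrev Aop (k : Type) [Field k] : Type := (AlgA k)ᵐᵒᵖ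

/-- The algebra homomorphism `A → k` corresponding to the vertex `i`. -/
noncomputable def simpleAlgHom (k : Type) [Field k] (i : Fin 3) : AlgA k →ₐ[k] k :=
  RingQuot.liftAlgHom k
    ⟨FreeAlgebra.lift k (fun g => match g with
        | QGen.e j => if j = i then (1 : k) else 0
        | QGen.ar _ => 0), by
      intro _x _y h
      induction h with
      | idem i j =>
          simp only [map_mul, FreeAlgebra.lift_ι_apply, apply_ite, map_zero]
          split_ifs <;> simp_all
      | sum =>
          simp only [map_add, map_one, FreeAlgebra.lift_ι_apply]
          fin_cases i <;> simp
      | src a => simp [FreeAlgebra.lift_ι_apply]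
      | tgt a => simp [FreeAlgebra.lift_ι_apply]
      | radsq a b => simp [FreeAlgebra.lift_ι_apply]⟩

/-- The ring homomorphism `Aᵐᵒᵖ → k` corresponding to the vertex `i`. -/
noncomputable def simpleRingHom (k : Type) [Field k] (i : Fin 3) : Aop k →+* k :=
  RingHom.fromOpposite (simpleAlgHom k i).toRingHom (fun _ _ => mul_comm _ _)

/-- The simple right `A`-module `S_{i+1}` at the vertex `i` (one-dimensional over `k`,
with `e i` acting as the identity and all arrows acting by zero).
So `SimpleS k 0 = S₁`, `SimpleS k 1 = S₂` and `SimpleS k 2 = S₃`. -/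
def SimpleS (k : Type) [Field k] (_i : Fin 3) : Type := k

instance (k : Type) [Field k] (i : Fin 3) : AddCommGroup (SimpleS k i) :=
  inferInstanceAs (AddCommGroup k)

instance (k : Type) [Field k] (i : Fin 3) : Module k (SimpleS k i) :=
  inferInstanceAs (Module k k)

noncomputable instance (k : Type) [Field k] (i : Fin 3) : Module (Aop k) (SimpleS k i) :=
  Module.compHom (SimpleS k i) (simpleRingHom k i)

/-- The underlying type of `D(A) = Hom_k(A, k)`. -/
abbrev DualA (k : Type) [Field k] : Type := AlgA k →ₗ[k] k

/-- The right `A`-module structure on `D(A)`: `(φ · a) x = φ (a * x)`. -/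
noncomputable instance (k : Type) [Field k] : Module (Aop k) (DualA k) where
  smul a φ := φ.comp (LinearMap.mulLeft k a.unop)
  one_smul φ := by
    show φ.comp (LinearMap.mulLeft k ((1 : Aop k).unop)) = φ
    ext x; simp
  mul_smul a b φ := by
    show φ.comp (LinearMap.mulLeft k ((a * b).unop)) =
      (φ.comp (LinearMap.mulLeft k b.unop)).comp (LinearMap.mulLeft k a.unop)
    ext x; simp [mul_assoc]
  smul_zero a := by
    show (0 : DualA k).comp (LinearMap.mulLeft k a.unop) = 0
    ext x; simp
  smul_add a φ ψ := by
    show (φ + ψ).comp (LinearMap.mulLeft k a.unop) =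
      φ.comp (LinearMap.mulLeft k a.unop) + ψ.comp (LinearMap.mulLeft k a.unop)
    ext x; simp
  add_smul a b φ := by
    show φ.comp (LinearMap.mulLeft k ((a + b).unop)) =
      φ.comp (LinearMap.mulLeft k a.unop) + φ.comp (LinearMap.mulLeft k b.unop)
    ext x; simp [add_mul]
  zero_smul φ := by
    show φ.comp (LinearMap.mulLeft k ((0 : Aop k).unop)) = 0
    ext x; simp

/-- The right `A`-module `M = A ⊕ D(A)`, where `A` carries the right regular
`A`-module structure. -/
abbrev MA (k : Type) [Field k] : Type := AlgA k × DualA k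

/-- `X` belongs to `add M`: `X` is (isomorphic to) a direct summand of `Mⁿ` for some `n`. -/
def InAdd (k : Type) [Field k] (M X : Type) [AddCommGroup M] [Module (Aop k) M]
    [AddCommGroup X] [Module (Aop k) X] : Prop :=
  ∃ (n : ℕ) (ι : X →ₗ[Aop k] (Fin n → M)) (π : (Fin n → M) →ₗ[Aop k] X),
    π.comp ι = LinearMap.id

/-- `Ext^i_A(X, Y)` for right `A`-modules `X` and `Y`, computed in the abelian
category of all right `A`-modules (which has the same `Ext` groups as `mod A`). -/
noncomputable def ExtA (k : Type) [Field k] (X Y : Type) [AddCommGroup X] [Module (Aop k) X]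
    [AddCommGroup Y] [Module (Aop k) Y] (i : ℕ) : Type :=
  ((Ext ℤ (ModuleCat (Aop k)) i).obj (op (ModuleCat.of (Aop k) X))).obj (ModuleCat.of (Aop k) Y)

/-- `M` is a 2-cluster tilting right `A`-module:
`add M = {X ∈ mod A | Ext¹_A(M,X) = 0} = {X ∈ mod A | Ext¹_A(X,M) = 0}`. -/
def IsTwoClusterTilting (k : Type) [Field k] (M : Type) [AddCommGroup M]
    [Module (Aop k) M] : Prop :=
  (∀ (X : Type) [AddCommGroup X] [Module (Aop k) X], Module.Finite (Aop k) X →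
    (InAdd k M X ↔ Subsingleton (ExtA k M X 1))) ∧
  (∀ (X : Type) [AddCommGroup X] [Module (Aop k) X], Module.Finite (Aop k) X →
    (InAdd k M X ↔ Subsingleton (ExtA k X M 1)))

section Algebra

variable (k : Type) [Field k]

/-- The images in `A` of the generators of the path algebra. -/
noncomputable def gen (g : QGen) : AlgA k :=
  RingQuot.mkAlgHom k (ARel k) (FreeAlgebra.ι k g)

/-- The generators of `A`, as elements of `Aᵐᵒᵖ`. -/
noncomputable def opGen (g : QGen) : Aop k := MulOpposite.op (gen k g)

lemma gen_e_mul_gen_e (i j : Fin 3) :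
    gen k (.e i) * gen k (.e j) = if i = j then gen k (.e i) else 0 := by
  have h := RingQuot.mkAlgHom_rel k (ARel.idem (k := k) i j)
  simpa [gen, apply_ite] using h

lemma gen_ar_mul_gen_ar (a b : Fin 4) : gen k (.ar a) * gen k (.ar b) = 0 := by
  simpa [gen] using RingQuot.mkAlgHom_rel k (ARel.radsq (k := k) a b)

lemma gen_e_mul_gen_ar (i : Fin 3) (a : Fin 4) :
    gen k (.e i) * gen k (.ar a) = if i = arrowSrc a then gen k (.ar a) else 0 := by
  have h : gen k (.e (arrowSrc a)) * gen k (.ar a) = gen k (.ar a) := by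
    simpa [gen] using RingQuot.mkAlgHom_rel k (ARel.src (k := k) a)
  split_ifs with hi
  · rw [hi, h]
  · rw [← h, ← mul_assoc, gen_e_mul_gen_e, if_neg hi, zero_mul]

lemma gen_ar_mul_gen_e (i : Fin 3) (a : Fin 4) :
    gen k (.ar a) * gen k (.e i) = if i = arrowTgt a then gen k (.ar a) else 0 := by
  have h : gen k (.ar a) * gen k (.e (arrowTgt a)) = gen k (.ar a) := by
    simpa [gen] using RingQuot.mkAlgHom_rel k (ARel.tgt (k := k) a)
  split_ifs with hi
  · rw [hi, h]
  · rw [← h, mul_assoc, gen_e_mul_gen_e, if_neg (Ne.symm hi), mul_zero]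

lemma gen_e_sum : ∑ i, gen k (.e i) = 1 := by
  simpa [gen, Fin.sum_univ_three] using RingQuot.mkAlgHom_rel k (ARel.sum (k := k))

lemma span_range_gen : Submodule.span k (Set.range (gen k)) = ⊤ := by
  set S := Submodule.span k (Set.range (gen k))
  have hgen (g : QGen) : gen k g ∈ S := Submodule.subset_span ⟨g, rfl⟩
  have hone : (1 : AlgA k) ∈ S := gen_e_sum k ▸ S.sum_mem fun i _ ↦ hgen _
  have hmul {a b : AlgA k} (ha : a ∈ S) (hb : b ∈ S) : a * b ∈ S := by
    have hab := Submodule.mul_mem_mul ha hb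
    rw [Submodule.span_mul_span] at hab
    refine Submodule.span_le.2 ?_ hab
    rintro _ ⟨_, ⟨g, rfl⟩, _, ⟨h, rfl⟩, rfl⟩
    rcases g with i | c <;> rcases h with j | d <;>
      simp only [gen_e_mul_gen_e, gen_e_mul_gen_ar, gen_ar_mul_gen_e, gen_ar_mul_gen_ar] <;>
      (try split_ifs) <;> first | exact hgen _ | exact S.zero_mem
  rw [eq_top_iff]
  intro a _
  obtain ⟨a, rfl⟩ := RingQuot.mkAlgHom_surjective k (ARel k) a
  induction a using FreeAlgebra.induction with
  | grade0 r =>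
    rw [AlgHom.commutes, Algebra.algebraMap_eq_smul_one]
    exact S.smul_mem r hone
  | grade1 g => exact hgen g
  | mul a b ha hb => rw [map_mul]; exact hmul (ha trivial) (hb trivial)
  | add a b ha hb => rw [map_add]; exact S.add_mem (ha trivial) (hb trivial)

variable {k}

lemma linearMap_ext_gen {V : Type*} [AddCommMonoid V] [Module k V] {f g : AlgA k →ₗ[k] V}
    (h : ∀ x, f (gen k x) = g (gen k x)) : f = g :=
  LinearMap.ext_on_range (span_range_gen k) h

variable (k)

/-- The representation of `A` on `k²` in which the arrow `c` acts nontrivially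
from one coordinate to the other. -/
noncomputable def arrowRep (c : Fin 4) : AlgA k →ₐ[k] Matrix (Fin 2) (Fin 2) k :=
  RingQuot.liftAlgHom k
    ⟨FreeAlgebra.lift k (fun g => match g with
        | QGen.e j => !![if j = arrowSrc c then 1 else 0, 0; 0, if j = arrowTgt c then 1 else 0]
        | QGen.ar d => !![0, if c = d then 1 else 0; 0, 0]), by
      intro _x _y h
      induction h with
      | idem i j =>
          by_cases hij : i = j <;> ext a b <;> fin_cases a <;> fin_cases b <;>
            simp [hij, FreeAlgebra.lift_ι_apply, Matrix.mul_apply] <;> grind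
      | sum =>
          ext a b
          fin_cases c <;> fin_cases a <;> fin_cases b <;>
            simp [FreeAlgebra.lift_ι_apply, arrowSrc, arrowTgt]
      | src d =>
          ext a b
          fin_cases a <;> fin_cases b <;>
            (simp [FreeAlgebra.lift_ι_apply, Matrix.mul_apply]; try grind)
      | tgt d =>
          ext a b
          fin_cases a <;> fin_cases b <;>
            (simp [FreeAlgebra.lift_ι_apply, Matrix.mul_apply]; try grind)
      | radsq a b =>
          ext i j
          fin_cases i <;> fin_cases j <;> simp [FreeAlgebra.lift_ι_apply, Matrix.mul_apply]⟩

/-- The coefficient of an element of `A` at the vertex `i`. -/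
noncomputable def vertexCoeff (i : Fin 3) : AlgA k →ₗ[k] k := (simpleAlgHom k i).toLinearMap

/-- The coefficient of an element of `A` at the arrow `c`. -/
noncomputable def arrowCoeff (c : Fin 4) : AlgA k →ₗ[k] k :=
  (Matrix.entryLinearMap k k 0 1).comp (arrowRep k c).toLinearMap

@[simp] lemma vertexCoeff_gen_e (i j : Fin 3) :
    vertexCoeff k i (gen k (.e j)) = if j = i then 1 else 0 := by
  simp [vertexCoeff, simpleAlgHom, gen, FreeAlgebra.lift_ι_apply]

@[simp] lemma vertexCoeff_gen_ar (i : Fin 3) (c : Fin 4) :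
    vertexCoeff k i (gen k (.ar c)) = 0 := by
  simp [vertexCoeff, simpleAlgHom, gen, FreeAlgebra.lift_ι_apply]

@[simp] lemma arrowCoeff_gen_e (c : Fin 4) (j : Fin 3) : arrowCoeff k c (gen k (.e j)) = 0 := by
  simp [arrowCoeff, arrowRep, gen, FreeAlgebra.lift_ι_apply]

@[simp] lemma arrowCoeff_gen_ar (c d : Fin 4) :
    arrowCoeff k c (gen k (.ar d)) = if c = d then 1 else 0 := by
  simp [arrowCoeff, arrowRep, gen, FreeAlgebra.lift_ι_apply]

variable {k}

lemma eq_sum_coeff (a : AlgA k) :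
    a = ∑ i, vertexCoeff k i a • gen k (.e i) + ∑ c, arrowCoeff k c a • gen k (.ar c) := by
  have h : LinearMap.id = ∑ i, (vertexCoeff k i).smulRight (gen k (.e i)) +
      ∑ c, (arrowCoeff k c).smulRight (gen k (.ar c)) := by
    apply linearMap_ext_gen
    rintro (i | c) <;> simp
  simpa using congr($h a)

lemma bilin_ext_gen {V : Type*} [AddCommMonoid V] [Module k V] {f g : AlgA k →ₗ[k] AlgA k →ₗ[k] V}
    (h : ∀ x y, f (gen k x) (gen k y) = g (gen k x) (gen k y)) : f = g :=
  linearMap_ext_gen fun x ↦ linearMap_ext_gen fun y ↦ h x y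

lemma vertexCoeff_mul (i : Fin 3) (a b : AlgA k) :
    vertexCoeff k i (a * b) = vertexCoeff k i a * vertexCoeff k i b := by
  simp [vertexCoeff]

lemma arrowCoeff_mul (c : Fin 4) (a b : AlgA k) :
    arrowCoeff k c (a * b) = vertexCoeff k (arrowSrc c) a * arrowCoeff k c b +
      arrowCoeff k c a * vertexCoeff k (arrowTgt c) b := by
  have h : (LinearMap.mul k (AlgA k)).compr₂ (arrowCoeff k c) =
      (LinearMap.mul k k).compl₁₂ (vertexCoeff k (arrowSrc c)) (arrowCoeff k c) +
      (LinearMap.mul k k).compl₁₂ (arrowCoeff k c) (vertexCoeff k (arrowTgt c)) := by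
    apply bilin_ext_gen
    rintro (i | d) (j | d') <;>
      simp [gen_e_mul_gen_e, gen_e_mul_gen_ar, gen_ar_mul_gen_e, gen_ar_mul_gen_ar] <;>
      split_ifs <;> simp_all <;> grind
  simpa using congr($h a b)

end Algebra

section Ext

variable {R : Type} [Ring R]

theorem subsingleton_ext_one_iff {N : ModuleCat.{0} R} (P : ProjectiveResolution N)
    (Y : ModuleCat.{0} R) :
    Subsingleton (((Ext ℤ (ModuleCat R) 1).obj (op N)).obj Y) ↔
      ∀ f : P.complex.X 1 ⟶ Y, P.complex.d 2 1 ≫ f = 0 →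
        ∃ g : P.complex.X 0 ⟶ Y, P.complex.d 1 0 ≫ g = f := by
  rw [← ModuleCat.isZero_iff_subsingleton, (P.isoExt 1 Y).isZero_iff,
    ← HomologicalComplex.exactAt_iff_isZero_homology,
    HomologicalComplex.exactAt_iff' _ 0 1 2 (by simp) (by simp),
    ShortComplex.moduleCat_exact_iff]
  rfl

variable {N Y : Type} [AddCommGroup N] [Module R N] [AddCommGroup Y] [Module R Y]

/-- If `Ext¹(N, Y) = 0`, then maps to `Y` from the kernel of a projective presentation of `N`
extend. -/
theorem exists_extend_of_subsingleton_ext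
    (h : Subsingleton (((Ext ℤ (ModuleCat R) 1).obj (op (ModuleCat.of R N))).obj
      (ModuleCat.of R Y)))
    {E : Type} [AddCommGroup E] [Module R E] [Module.Projective R E] (π : E →ₗ[R] N)
    (hπ : Function.Surjective π) (f : LinearMap.ker π →ₗ[R] Y) :
    ∃ g : E →ₗ[R] Y, ∀ x, g x.1 = f x := by
  let P := projectiveResolution (ModuleCat.of R N)
  let d := (P.complex.d 1 0).hom
  let ε : P.complex.X 0 →ₗ[R] N := (P.π.f 0).hom
  have : Module.Projective R (P.complex.X 0) :=
    (IsProjective.iff_projective _).2 (P.projective 0)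
  have hε : Function.Surjective ε := (ModuleCat.epi_iff_surjective _).1 inferInstance
  have hεd (t) : ε (d t) = 0 := congr($(P.complex_d_comp_π_f_zero).hom t)
  have hex (p) (hp : ε p = 0) : ∃ t, d t = p := (ShortComplex.moduleCat_exact_iff _).1 P.exact₀ p hp
  obtain ⟨u, hu⟩ := Module.projective_lifting_property π ε hπ
  obtain ⟨v, hv⟩ := Module.projective_lifting_property ε π hε
  have hu' (x) : π (u x) = ε x := congr($hu x)
  have hv' (x) : ε (v x) = π x := congr($hv x)
  let ud : P.complex.X 1 →ₗ[R] LinearMap.ker π :=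
    (u ∘ₗ d).codRestrict _ fun t ↦ by simp [hu', hεd]
  obtain ⟨g, hg⟩ := (subsingleton_ext_one_iff P _).1 h (ModuleCat.ofHom (f ∘ₗ ud)) (by
    ext t
    have : ud (P.complex.d 2 1 t) = 0 := by
      ext
      have : d (P.complex.d 2 1 t) = 0 := congr($(P.complex.d_comp_d 2 1 0).hom t)
      simp [ud, this]
    simp [this])
  have hg' (t) : g (d t) = f (ud t) := congr($(hg).hom t)
  refine ⟨g.hom ∘ₗ v + f ∘ₗ (LinearMap.id - u ∘ₗ v).codRestrict _ fun x ↦ by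
    simp [hu', hv'], fun x ↦ ?_⟩
  obtain ⟨t, ht⟩ := hex (v x) (by rw [hv']; exact x.2)
  have : g.hom (v x) = f (ud t) := by rw [← ht]; exact hg' t
  simp only [LinearMap.add_apply, LinearMap.comp_apply, this, ← map_add]
  congr 1
  ext
  simp [ud, ht]

variable (R N Y) in
/-- Maps out of `N` lift along every surjection with kernel isomorphic to `Y`. -/
def MapsLift : Prop :=
  ∀ (E B : Type) [AddCommGroup E] [Module R E] [AddCommGroup B] [Module R B]
    (i : Y →ₗ[R] E) (π : E →ₗ[R] B), Function.Injective i → Function.Surjective π →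
    Function.Exact i π → ∀ φ : N →ₗ[R] B, ∃ s : N →ₗ[R] E, π ∘ₗ s = φ

theorem MapsLift.subsingleton_ext (h : MapsLift R N Y) :
    Subsingleton (((Ext ℤ (ModuleCat R) 1).obj (op (ModuleCat.of R N))).obj
      (ModuleCat.of R Y)) := by
  let P := projectiveResolution (ModuleCat.of R N)
  rw [subsingleton_ext_one_iff P]
  intro f hf
  let d := (P.complex.d 1 0).hom
  let ε : P.complex.X 0 →ₗ[R] N := (P.π.f 0).hom
  have hε : Function.Surjective ε := (ModuleCat.epi_iff_surjective _).1 inferInstance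
  have hεd (t) : ε (d t) = 0 := congr($(P.complex_d_comp_π_f_zero).hom t)
  have hex (p) (hp : ε p = 0) : ∃ t, d t = p := (ShortComplex.moduleCat_exact_iff _).1 P.exact₀ p hp
  have hex' (t) (ht : d t = 0) : f.hom t = 0 := by
    obtain ⟨s, rfl⟩ := (ShortComplex.moduleCat_exact_iff _).1 (P.exact_succ 0) t ht
    exact congr($(hf).hom s)
  let S := LinearMap.range ((-f.hom).prod d)
  let i : Y →ₗ[R] (Y × P.complex.X 0) ⧸ S := S.mkQ ∘ₗ LinearMap.inl R _ _
  let j : P.complex.X 0 →ₗ[R] (Y × P.complex.X 0) ⧸ S := S.mkQ ∘ₗ LinearMap.inr R _ _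
  have hij (t) : j (d t) = i (f.hom t) :=
    (Submodule.Quotient.eq S).2 ⟨t, by simp [d]⟩
  let π : ((Y × P.complex.X 0) ⧸ S) →ₗ[R] N := S.liftQ (ε ∘ₗ LinearMap.snd R _ _) (by
    rintro _ ⟨t, rfl⟩
    simp [hεd])
  have hπj (p) : π (j p) = ε p := by simp [π, j]
  have hi : Function.Injective i := by
    rw [injective_iff_map_eq_zero]
    intro y hy
    obtain ⟨t, ht⟩ := (Submodule.Quotient.mk_eq_zero S).1 hy
    have h1 : d t = 0 := congr($ht.2)
    have h2 : -f.hom t = y := congr($ht.1)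
    rw [← h2, hex' t h1, neg_zero]
  have hexact (z) (hz : π z = 0) : ∃ y, i y = z := by
    obtain ⟨⟨y, p⟩, rfl⟩ := S.mkQ_surjective z
    obtain ⟨t, rfl⟩ := hex p (by simpa [π] using hz)
    refine ⟨y + f.hom t, ?_⟩
    rw [map_add, ← hij]
    simp [i, j, ← Submodule.Quotient.mk_add]
  have hπi (y) : π (i y) = 0 := by simp [π, i]
  obtain ⟨s, hs⟩ := h _ _ i π hi
    (fun n ↦ (hε n).imp' j fun p hp ↦ by rw [hπj, hp])
    (fun z ↦ ⟨hexact z, by rintro ⟨y, rfl⟩; exact hπi y⟩) LinearMap.id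
  have hs' (n) : π (s n) = n := congr($hs n)
  let r : P.complex.X 0 →ₗ[R] LinearMap.range i :=
    (j - s ∘ₗ ε).codRestrict _ fun p ↦ hexact _ (by simp [hs', hπj])
  let e := LinearEquiv.ofInjective i hi
  refine ⟨ModuleCat.ofHom (e.symm.toLinearMap ∘ₗ r), ?_⟩
  ext t
  change e.symm (r (d t)) = f.hom t
  rw [LinearEquiv.symm_apply_eq]
  ext
  change j (d t) - s (ε (d t)) = i (f.hom t)
  rw [hεd, map_zero, sub_zero, hij]

theorem MapsLift.of_projective [Module.Projective R N] : MapsLift R N Y :=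
  fun _ _ _ _ _ _ _ π _ hπ _ φ ↦ Module.projective_lifting_property π φ hπ

theorem MapsLift.of_comp_eq_id {N' : Type} [AddCommGroup N'] [Module R N'] (h : MapsLift R N Y)
    (ι : N' →ₗ[R] N) (p : N →ₗ[R] N') (hp : p ∘ₗ ι = LinearMap.id) : MapsLift R N' Y := by
  intro E B _ _ _ _ i π hi hπ hex φ
  obtain ⟨s, hs⟩ := h E B i π hi hπ hex (φ ∘ₗ p)
  exact ⟨s ∘ₗ ι, by rw [← LinearMap.comp_assoc, hs, LinearMap.comp_assoc, hp, LinearMap.comp_id]⟩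

theorem MapsLift.pi {I : Type} [Fintype I] [DecidableEq I] (h : MapsLift R N Y) :
    MapsLift R (I → N) Y := by
  intro E B _ _ _ _ i π hi hπ hex φ
  choose s hs using fun a ↦ h E B i π hi hπ hex (φ ∘ₗ LinearMap.single R (fun _ ↦ N) a)
  refine ⟨LinearMap.lsum R _ ℕ s, LinearMap.pi_ext' fun a ↦ ?_⟩
  ext x
  simpa [Pi.single_apply, apply_ite] using congr($(hs a) x)

theorem MapsLift.prod {N' : Type} [AddCommGroup N'] [Module R N']
    (h : MapsLift R N Y) (h' : MapsLift R N' Y) : MapsLift R (N × N') Y := by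
  intro E B _ _ _ _ i π hi hπ hex φ
  obtain ⟨s, hs⟩ := h E B i π hi hπ hex (φ ∘ₗ LinearMap.inl R N N')
  obtain ⟨s', hs'⟩ := h' E B i π hi hπ hex (φ ∘ₗ LinearMap.inr R N N')
  exact ⟨s.coprod s', by rw [LinearMap.comp_coprod, hs, hs', ← LinearMap.comp_coprod,
    LinearMap.coprod_inl_inr, LinearMap.comp_id]⟩

theorem subsingleton_ext_of_retract {N' Y' : Type} [AddCommGroup N'] [Module R N']
    [AddCommGroup Y'] [Module R Y'] {n : ℕ}
    (h : Subsingleton (((Ext ℤ (ModuleCat R) n).obj (op (ModuleCat.of R N))).obj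
      (ModuleCat.of R Y)))
    (ι : N' →ₗ[R] N) (p : N →ₗ[R] N') (hp : p ∘ₗ ι = LinearMap.id)
    (ι' : Y' →ₗ[R] Y) (p' : Y →ₗ[R] Y') (hp' : p' ∘ₗ ι' = LinearMap.id) :
    Subsingleton (((Ext ℤ (ModuleCat R) n).obj (op (ModuleCat.of R N'))).obj
      (ModuleCat.of R Y')) := by
  let F := Ext ℤ (ModuleCat R) n
  have h₁ : F.map (ModuleCat.ofHom p).op ≫ F.map (ModuleCat.ofHom ι).op = 𝟙 _ := by
    rw [← F.map_comp, ← op_comp, ← ModuleCat.ofHom_comp, hp]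
    exact F.map_id _
  have h₂ : (F.obj (op (ModuleCat.of R N'))).map (ModuleCat.ofHom ι') ≫
      (F.obj (op (ModuleCat.of R N'))).map (ModuleCat.ofHom p') = 𝟙 _ := by
    rw [← Functor.map_comp, ← ModuleCat.ofHom_comp, hp']
    exact (F.obj _).map_id _
  rw [← ModuleCat.isZero_iff_subsingleton] at h ⊢
  rw [Limits.IsZero.iff_id_eq_zero, ← h₂, ← Category.comp_id ((F.obj _).map (ModuleCat.ofHom ι')),
    ← NatTrans.id_app, ← h₁, NatTrans.comp_app, h.eq_of_tgt ((F.map _).app _) 0]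
  simp

end Ext

section Modules

variable {k : Type} [Field k]

instance : IsScalarTower k (Aop k) (DualA k) :=
  .of_algebraMap_smul fun r φ ↦ by
    ext x
    change φ (algebraMap k (AlgA k) r * x) = r • φ x
    rw [← Algebra.smul_def, map_smul]

lemma dualA_smul_apply (a : Aop k) (φ : DualA k) (x : AlgA k) : (a • φ) x = φ (a.unop * x) := rfl

instance : Module.Finite k (AlgA k) :=
  ⟨Submodule.fg_def.2 ⟨Set.range (gen k), by
    have : Finite QGen := .of_surjective (Sum.elim QGen.e QGen.ar) fun
      | .e i => ⟨.inl i, rfl⟩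
      | .ar c => ⟨.inr c, rfl⟩
    exact Set.finite_range _, span_range_gen k⟩⟩

lemma opGen_smul_opGen_smul {X : Type*} [AddCommGroup X] [Module (Aop k) X] (g h : QGen) (x : X) :
    opGen k g • opGen k h • x = MulOpposite.op (gen k h * gen k g) • x :=
  (mul_smul _ _ _).symm

section

variable {X : Type*} [AddCommGroup X] [Module (Aop k) X]

lemma e_smul_e_smul (i j : Fin 3) (x : X) :
    opGen k (.e i) • opGen k (.e j) • x = if i = j then opGen k (.e i) • x else 0 := by
  rw [opGen_smul_opGen_smul, gen_e_mul_gen_e]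
  split_ifs <;> simp_all [opGen]

lemma ar_smul_ar_smul (c d : Fin 4) (x : X) : opGen k (.ar c) • opGen k (.ar d) • x = 0 := by
  simp [opGen_smul_opGen_smul, gen_ar_mul_gen_ar]

lemma e_smul_ar_smul (i : Fin 3) (c : Fin 4) (x : X) :
    opGen k (.e i) • opGen k (.ar c) • x = if i = arrowTgt c then opGen k (.ar c) • x else 0 := by
  rw [opGen_smul_opGen_smul, gen_ar_mul_gen_e]
  split_ifs <;> simp_all [opGen]

lemma ar_smul_e_smul (i : Fin 3) (c : Fin 4) (x : X) :
    opGen k (.ar c) • opGen k (.e i) • x = if i = arrowSrc c then opGen k (.ar c) • x else 0 := by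
  rw [opGen_smul_opGen_smul, gen_e_mul_gen_ar]
  split_ifs <;> simp_all [opGen]

lemma sum_e_smul (x : X) : ∑ i, opGen k (.e i) • x = x := by
  have : ∑ i, opGen k (.e i) = 1 := by
    simp only [opGen, ← Finset.op_sum, gen_e_sum, MulOpposite.op_one]
  rw [← Finset.sum_smul, this, one_smul]

lemma opGen_smul_smul [Module k X] [IsScalarTower k (Aop k) X] (g : QGen) (r : k) (x : X) :
    opGen k g • r • x = r • opGen k g • x :=
  smul_algebra_smul_comm r (opGen k g) x

lemma ar_smul_eq_zero_of_ne {i : Fin 3} {c : Fin 4} {x : X} (hx : opGen k (.e i) • x = x)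
    (hi : i ≠ arrowSrc c) : opGen k (.ar c) • x = 0 := by
  rw [← hx, ar_smul_e_smul, if_neg hi]

end

/-- A `k`-linear map commuting with the generators of `A` is `A`-linear. -/
def linearMapOfGen {X Y : Type*} [AddCommGroup X] [Module (Aop k) X] [AddCommGroup Y]
    [Module (Aop k) Y] [Module k X] [IsScalarTower k (Aop k) X] [Module k Y]
    [IsScalarTower k (Aop k) Y] (f : X →ₗ[k] Y)
    (h : ∀ g x, f (opGen k g • x) = opGen k g • f x) : X →ₗ[Aop k] Y where
  __ := f
  map_smul' a x := by
    obtain ⟨a, rfl⟩ := MulOpposite.op_surjective a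
    have ha : a ∈ Submodule.span k (Set.range (gen k)) := span_range_gen k ▸ trivial
    change f (MulOpposite.op a • x) = MulOpposite.op a • f x
    induction ha using Submodule.span_induction with
    | mem _ hg => obtain ⟨g, rfl⟩ := hg; exact h g x
    | zero => simp
    | add a b _ _ ha hb => simp [add_smul, ha, hb]
    | smul r a _ ha => simp only [MulOpposite.op_smul, smul_assoc, map_smul, ha]

@[simp] lemma linearMapOfGen_apply {X Y : Type*} [AddCommGroup X] [Module (Aop k) X]
    [AddCommGroup Y] [Module (Aop k) Y] [Module k X] [IsScalarTower k (Aop k) X] [Module k Y]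
    [IsScalarTower k (Aop k) Y] (f : X →ₗ[k] Y)
    (h : ∀ g x, f (opGen k g • x) = opGen k g • f x) (x : X) : linearMapOfGen f h x = f x := rfl

variable (k) in
/-- The socle of `X` is contained in its radical: every element annihilated by all arrows
is a sum of images of arrows. -/
def SocleLeRadical (X : Type*) [AddCommGroup X] [Module (Aop k) X] : Prop :=
  ∀ x : X, (∀ c, opGen k (.ar c) • x = 0) → ∃ u : Fin 4 → X, x = ∑ c, opGen k (.ar c) • u c

lemma SocleLeRadical.of_comp_eq_id {X Y : Type*} [AddCommGroup X] [Module (Aop k) X]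
    [AddCommGroup Y] [Module (Aop k) Y] (h : SocleLeRadical k Y) (ι : X →ₗ[Aop k] Y)
    (p : Y →ₗ[Aop k] X) (hp : p ∘ₗ ι = LinearMap.id) : SocleLeRadical k X := by
  intro x hx
  obtain ⟨u, hu⟩ := h (ι x) fun c ↦ by rw [← map_smul, hx, map_zero]
  refine ⟨fun c ↦ p (u c), ?_⟩
  calc x = p (ι x) := congr($hp x).symm
    _ = _ := by simp [hu]

lemma SocleLeRadical.pi {I X : Type*} [AddCommGroup X] [Module (Aop k) X]
    (h : SocleLeRadical k X) : SocleLeRadical k (I → X) := by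
  intro x hx
  choose u hu using fun a ↦ h (x a) fun c ↦ congr_fun (hx c) a
  exact ⟨fun c a ↦ u a c, by ext a; simpa using hu a⟩

lemma SocleLeRadical.prod {X Y : Type*} [AddCommGroup X] [Module (Aop k) X]
    [AddCommGroup Y] [Module (Aop k) Y] (hX : SocleLeRadical k X) (hY : SocleLeRadical k Y) :
    SocleLeRadical k (X × Y) := by
  intro x hx
  obtain ⟨u, hu⟩ := hX x.1 fun c ↦ congr($(hx c).1)
  obtain ⟨v, hv⟩ := hY x.2 fun c ↦ congr($(hx c).2)
  exact ⟨fun c ↦ (u c, v c), by ext <;> simpa [Prod.fst_sum, Prod.snd_sum]⟩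

/-- An element of the socle concentrated at the vertex `j` comes from the arrows into `j`. -/
lemma SocleLeRadical.exists_eq_sum {X : Type*} [AddCommGroup X] [Module (Aop k) X]
    (h : SocleLeRadical k X) {j : Fin 3} {x : X} (hxj : opGen k (.e j) • x = x)
    (hx : ∀ c, opGen k (.ar c) • x = 0) :
    ∃ u : Fin 4 → X, (∀ c, opGen k (.e (arrowSrc c)) • u c = u c) ∧
      x = ∑ c, if j = arrowTgt c then opGen k (.ar c) • u c else 0 := by
  obtain ⟨u, hu⟩ := h x hx
  refine ⟨fun c ↦ opGen k (.e (arrowSrc c)) • u c, fun c ↦ by simp [e_smul_e_smul], ?_⟩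
  rw [← hxj, hu]
  simp [Finset.smul_sum, e_smul_ar_smul, ar_smul_e_smul]

lemma socleLeRadical_algA : SocleLeRadical k (AlgA k) := by
  intro a ha
  have hv (c) : vertexCoeff k (arrowSrc c) a = 0 := by
    have : a * gen k (.ar c) = 0 := ha c
    simpa [arrowCoeff_mul] using congr(arrowCoeff k c $this)
  have hv' (i) : vertexCoeff k i a = 0 := by
    fin_cases i
    exacts [hv 0, hv 1, hv 3]
  refine ⟨fun c ↦ arrowCoeff k c a • 1, (eq_sum_coeff a).trans ?_⟩
  simp [hv', opGen]

/-- The `vertexCoeff`s and `arrowCoeff`s span `D(A)`;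
every element of `D(A)` is determined by its values on the generators. -/
lemma dualA_eq_sum (ψ : DualA k) :
    ψ = ∑ i, ψ (gen k (.e i)) • vertexCoeff k i + ∑ c, ψ (gen k (.ar c)) • arrowCoeff k c := by
  apply linearMap_ext_gen
  rintro (i | c) <;> simp

lemma e_smul_arrowCoeff (i : Fin 3) (c : Fin 4) :
    opGen k (.e i) • arrowCoeff k c = if i = arrowSrc c then arrowCoeff k c else 0 := by
  apply linearMap_ext_gen
  rintro (i | c) <;> simp [dualA_smul_apply, opGen, arrowCoeff_mul] <;> split_ifs <;> simp_all

lemma ar_smul_arrowCoeff (c d : Fin 4) :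
    opGen k (.ar c) • arrowCoeff k d = if c = d then vertexCoeff k (arrowTgt d) else 0 := by
  apply linearMap_ext_gen
  rcases eq_or_ne c d with rfl | h
  · rintro (i | c) <;> simp [dualA_smul_apply, opGen, arrowCoeff_mul]
  · rintro (i | c) <;> simp [dualA_smul_apply, opGen, arrowCoeff_mul, h, h.symm]

lemma socleLeRadical_dualA : SocleLeRadical k (DualA k) := by
  intro ψ hψ
  have hc (c) : ψ (gen k (.ar c)) = 0 := by
    have h : (opGen k (.ar c) • ψ) 1 = 0 := by rw [hψ]; rfl
    rwa [dualA_smul_apply, opGen, MulOpposite.unop_op, mul_one] at h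
  refine ⟨![ψ (gen k (.e 1)) • arrowCoeff k 0, ψ (gen k (.e 0)) • arrowCoeff k 1,
    ψ (gen k (.e 2)) • arrowCoeff k 2, 0], (dualA_eq_sum ψ).trans ?_⟩
  have h (c d) (r : k) : opGen k (.ar c) • r • arrowCoeff k d =
      if c = d then r • vertexCoeff k (arrowTgt d) else 0 := by
    have h := opGen_smul_smul (.ar c) r (arrowCoeff k d)
    rw [h, ar_smul_arrowCoeff]
    split_ifs <;> simp
  simp [hc, Fin.sum_univ_four, Fin.sum_univ_three, h, arrowTgt]
  abel

lemma socleLeRadical_MA : SocleLeRadical k (MA k) := socleLeRadical_algA.prod socleLeRadical_dualA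

/-- `A`-linear maps out of `D(A)` correspond to images `w` and `x` of the basis of `D(A)` dual
to the basis of `A` consisting of vertices and arrows. -/
noncomputable def dualALift {X : Type*} [AddCommGroup X] [Module (Aop k) X] [Module k X]
    [IsScalarTower k (Aop k) X] (w : Fin 3 → X) (x : Fin 4 → X)
    (hw : ∀ i j, opGen k (.e i) • w j = if i = j then w j else 0)
    (hwc : ∀ c j, opGen k (.ar c) • w j = 0)
    (hx : ∀ i c, opGen k (.e i) • x c = if i = arrowSrc c then x c else 0)
    (hxc : ∀ c d, opGen k (.ar c) • x d = if c = d then w (arrowTgt d) else 0) :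
    DualA k →ₗ[Aop k] X :=
  linearMapOfGen
    (∑ i, (LinearMap.applyₗ (gen k (.e i))).smulRight (w i) +
      ∑ c, (LinearMap.applyₗ (gen k (.ar c))).smulRight (x c)) (by
    rintro (i | c) ψ <;>
    simp [dualA_smul_apply, Finset.smul_sum, opGen_smul_smul, hw, hwc, hx, hxc]
    · simp [opGen, gen_e_mul_gen_e, gen_e_mul_gen_ar, apply_ite ψ]
    · simp [opGen, gen_ar_mul_gen_e, gen_ar_mul_gen_ar, apply_ite ψ])

end Modules

section Lifting

variable {k : Type} [Field k]

/-- The underlying `k`-module of a right `A`-module. -/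
abbrev baseModule (k : Type) [Field k] (X : Type*) [AddCommGroup X] [Module (Aop k) X] :
    Module k X :=
  Module.compHom X (algebraMap k (Aop k))

lemma dualALift_arrowCoeff {X : Type*} [AddCommGroup X] [Module (Aop k) X] [Module k X]
    [IsScalarTower k (Aop k) X] {w : Fin 3 → X} {x : Fin 4 → X} (hw hwc hx hxc) (c : Fin 4) :
    dualALift (k := k) w x hw hwc hx hxc (arrowCoeff k c) = x c := by
  simp [dualALift]

lemma dualALift_apply {X : Type*} [AddCommGroup X] [Module (Aop k) X] [Module k X]
    [IsScalarTower k (Aop k) X] {w : Fin 3 → X} {x : Fin 4 → X} (hw hwc hx hxc) (ψ : DualA k) :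
    dualALift (k := k) w x hw hwc hx hxc ψ =
      ∑ i, ψ (gen k (.e i)) • w i + ∑ c, ψ (gen k (.ar c)) • x c := by
  simp [dualALift]

lemma exists_ar_smul_arrowCoeff (i : Fin 3) :
    ∃ c, opGen k (.ar c) • arrowCoeff k c = vertexCoeff k i := by
  fin_cases i
  · exact ⟨1, by rw [ar_smul_arrowCoeff, if_pos rfl]; rfl⟩
  · exact ⟨0, by rw [ar_smul_arrowCoeff, if_pos rfl]; rfl⟩
  · exact ⟨2, by rw [ar_smul_arrowCoeff, if_pos rfl]; rfl⟩

/-- The module `D(A)` is generated by the elements dual to the arrows. -/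
lemma dualA_hom_ext {B : Type*} [AddCommGroup B] [Module (Aop k) B] {f g : DualA k →ₗ[Aop k] B}
    (h : ∀ c, f (arrowCoeff k c) = g (arrowCoeff k c)) : f = g := by
  let _ := baseModule k B
  have : IsScalarTower k (Aop k) B := .of_algebraMap_smul fun _ _ ↦ rfl
  have h' (i) : f (vertexCoeff k i) = g (vertexCoeff k i) := by
    obtain ⟨c, hc⟩ := exists_ar_smul_arrowCoeff (k := k) i
    rw [← hc, map_smul, map_smul, h]
  have key (f : DualA k →ₗ[Aop k] B) (ψ : DualA k) : f ψ =
      ∑ i, ψ (gen k (.e i)) • f (vertexCoeff k i) +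
        ∑ c, ψ (gen k (.ar c)) • f (arrowCoeff k c) := by
    conv_lhs => rw [dualA_eq_sum ψ]
    simp only [map_add, map_sum, LinearMap.map_smul_of_tower]
  ext1 ψ
  rw [key f, key g]
  simp only [h, h']

theorem SocleLeRadical.mapsLift_dualA {X : Type} [AddCommGroup X] [Module (Aop k) X]
    (hX : SocleLeRadical k X) : MapsLift (Aop k) (DualA k) X := by
  intro E B _ _ _ _ i π hi hπ hex φ
  let _ := baseModule k E
  have : IsScalarTower k (Aop k) E := .of_algebraMap_smul fun _ _ ↦ rfl
  have hlift (c) : ∃ x, π x = φ (arrowCoeff k c) ∧ opGen k (.e (arrowSrc c)) • x = x := by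
    obtain ⟨x, hx⟩ := hπ (φ (arrowCoeff k c))
    refine ⟨opGen k (.e (arrowSrc c)) • x, ?_, by rw [e_smul_e_smul, if_pos rfl]⟩
    rw [map_smul, hx, ← map_smul, e_smul_arrowCoeff, if_pos rfl]
  choose x hx hxe using hlift
  have hπi (y) : π (i y) = 0 := (hex _).2 ⟨y, rfl⟩
  have hπar (c d) : π (opGen k (.ar c) • x d) =
      if c = d then φ (vertexCoeff k (arrowTgt d)) else 0 := by
    rw [map_smul, hx, ← map_smul, ar_smul_arrowCoeff]
    split_ifs <;> simp
  have hsocle (z : E) (j) (hz : opGen k (.e j) • z = z) (hc : ∀ c, opGen k (.ar c) • z = 0)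
      (hπz : π z = 0) : ∃ u : Fin 4 → X, (∀ c, opGen k (.e (arrowSrc c)) • u c = u c) ∧
        z = ∑ c, if j = arrowTgt c then opGen k (.ar c) • i (u c) else 0 := by
    obtain ⟨y, rfl⟩ := (hex z).1 hπz
    obtain ⟨u, hu, hy⟩ := hX.exists_eq_sum (j := j) (hi (by rw [map_smul, hz]))
      fun c ↦ hi (by rw [map_smul, hc, map_zero])
    refine ⟨u, hu, ?_⟩
    conv_lhs => rw [hy]
    simp [apply_ite i]
  obtain ⟨a, ha, ha'⟩ := hsocle (opGen k (.ar 1) • x 2) 0 (by simp [e_smul_ar_smul, arrowTgt])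
    (by simp [ar_smul_ar_smul]) (by simp [hπar])
  obtain ⟨b, hb, hb'⟩ := hsocle (opGen k (.ar 0) • x 0 - opGen k (.ar 3) • x 3) 1
    (by simp [smul_sub, e_smul_ar_smul, arrowTgt]) (by simp [smul_sub, ar_smul_ar_smul])
    (by simp [map_sub, hπar, arrowTgt])
  obtain ⟨d, hd, hd'⟩ := hsocle (opGen k (.ar 2) • x 1) 2 (by simp [e_smul_ar_smul, arrowTgt])
    (by simp [ar_smul_ar_smul]) (by simp [hπar])
  simp [Fin.sum_univ_four, arrowTgt] at ha' hb' hd'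
  have hie {j : Fin 3} {y : X} (h : opGen k (.e j) • y = y) : opGen k (.e j) • i y = i y := by
    rw [← map_smul, h]
  let x' : Fin 4 → E := ![x 0 - i (b 0), x 1 - i (d 2), x 2 - i (a 1), x 3 + i (b 3)]
  have hx'e (c) : opGen k (.e (arrowSrc c)) • x' c = x' c := by
    fin_cases c
    · exact (smul_sub _ _ _).trans (congr_arg₂ _ (hxe 0) (hie (hb 0)))
    · exact (smul_sub _ _ _).trans (congr_arg₂ _ (hxe 1) (hie (hd 2)))
    · exact (smul_sub _ _ _).trans (congr_arg₂ _ (hxe 2) (hie (ha 1)))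
    · exact (smul_add _ _ _).trans (congr_arg₂ _ (hxe 3) (hie (hb 3)))
  have hx'π (c) : π (x' c) = φ (arrowCoeff k c) := by
    fin_cases c <;> simp [x', hx, hπi]
  have h12 : opGen k (.ar 1) • x' 2 = 0 := by simp [x', smul_sub, ha']
  have h21 : opGen k (.ar 2) • x' 1 = 0 := by simp [x', smul_sub, hd']
  have h03 : opGen k (.ar 3) • x' 3 = opGen k (.ar 0) • x' 0 := by
    rw [sub_eq_iff_eq_add] at hb'
    simp [x', smul_sub, smul_add, hb']
    abel
  have hne (c d) (h : arrowSrc d ≠ arrowSrc c) : opGen k (.ar c) • x' d = 0 :=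
    ar_smul_eq_zero_of_ne (hx'e d) h
  clear_value x'
  refine ⟨dualALift ![opGen k (.ar 1) • x' 1, opGen k (.ar 0) • x' 0, opGen k (.ar 2) • x' 2] x'
    ?_ ?_ ?_ ?_, dualA_hom_ext fun c ↦ ?_⟩
  · intro i j
    fin_cases j <;> exact e_smul_ar_smul i _ _
  · intro c j
    fin_cases j <;> simp [ar_smul_ar_smul]
  · intro i c
    rw [← hx'e c, e_smul_e_smul]
    split_ifs <;> simp_all
  · intro c d
    fin_cases c <;> fin_cases d <;>
      first | exact h12 | exact h21 | exact h03 | rfl | (refine hne _ _ ?_; decide)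
  · rw [LinearMap.comp_apply, dualALift_arrowCoeff, hx'π]

/-- The regular right module is free of rank one. -/
def algAEquiv (k : Type) [Field k] : Aop k ≃ₗ[Aop k] AlgA k where
  toFun := MulOpposite.unop
  invFun := MulOpposite.op
  map_add' _ _ := rfl
  map_smul' _ _ := rfl

instance : Module.Projective (Aop k) (AlgA k) := .of_equiv (algAEquiv k)

theorem SocleLeRadical.mapsLift_MA {X : Type} [AddCommGroup X] [Module (Aop k) X]
    (hX : SocleLeRadical k X) : MapsLift (Aop k) (MA k) X :=
  MapsLift.of_projective.prod hX.mapsLift_dualA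

end Lifting

section Simple

variable {k : Type} [Field k]

instance (j : Fin 3) : IsScalarTower k (Aop k) (SimpleS k j) :=
  .of_algebraMap_smul fun r s ↦ by
    change simpleAlgHom k j (algebraMap k (AlgA k) r) • s = r • s
    rw [AlgHom.commutes]; rfl

lemma simpleS_smul_def (j : Fin 3) (a : Aop k) (s : SimpleS k j) :
    a • s = vertexCoeff k j a.unop • s := rfl

lemma e_smul_simpleS (i j : Fin 3) (s : SimpleS k j) :
    opGen k (.e i) • s = if i = j then s else 0 := by
  rw [simpleS_smul_def, opGen, MulOpposite.unop_op, vertexCoeff_gen_e]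
  split_ifs <;> simp

lemma ar_smul_simpleS (c : Fin 4) (j : Fin 3) (s : SimpleS k j) : opGen k (.ar c) • s = 0 := by
  rw [simpleS_smul_def, opGen, MulOpposite.unop_op, vertexCoeff_gen_ar, zero_smul]

/-- If the socle of `X` is not contained in its radical, then `X` has a simple direct summand. -/
lemma exists_simple_retract {X : Type} [AddCommGroup X] [Module (Aop k) X]
    (hX : ¬ SocleLeRadical k X) :
    ∃ (j : Fin 3) (ι : SimpleS k j →ₗ[Aop k] X) (p : X →ₗ[Aop k] SimpleS k j),
      p ∘ₗ ι = LinearMap.id := by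
  let _ := baseModule k X
  have : IsScalarTower k (Aop k) X := .of_algebraMap_smul fun _ _ ↦ rfl
  obtain ⟨x, hx, hxr⟩ : ∃ x : X, (∀ c, opGen k (.ar c) • x = 0) ∧
      ∀ u : Fin 4 → X, x ≠ ∑ c, opGen k (.ar c) • u c := by
    simpa [SocleLeRadical] using hX
  let R : (Fin 4 → X) →ₗ[k] X :=
    ∑ c, Algebra.lsmul k k X (opGen k (.ar c)) ∘ₗ LinearMap.proj c
  have hR (u) : R u = ∑ c, opGen k (.ar c) • u c := by simp [R]
  obtain ⟨j, hj⟩ : ∃ j, opGen k (.e j) • x ∉ LinearMap.range R := by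
    by_contra! h
    obtain ⟨u, hu⟩ := (sum_e_smul (k := k) x) ▸ Submodule.sum_mem (LinearMap.range R)
      fun i (_ : i ∈ Finset.univ) ↦ h i
    exact hxr u (by rw [← hu, hR])
  set w := opGen k (.e j) • x with hw
  obtain ⟨φ, hφw, hφ⟩ : ∃ φ : X →ₗ[k] k, φ w = 1 ∧ ∀ u, φ (R u) = 0 := by
    obtain ⟨φ, hφw, hφ⟩ := Submodule.exists_dual_map_eq_bot_of_notMem hj inferInstance
    refine ⟨(φ w)⁻¹ • φ, by simp [hφw], fun u ↦ ?_⟩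
    have : φ (R u) = 0 := by
      rw [← Submodule.mem_bot k, ← hφ]
      exact ⟨_, ⟨u, rfl⟩, rfl⟩
    simp [this]
  have hφ' (c y) : φ (opGen k (.ar c) • y) = 0 := by
    simpa [hR, Pi.single_apply, apply_ite (fun x ↦ opGen k _ • x)] using hφ (Pi.single c y)
  have hwe (i) : opGen k (.e i) • w = if i = j then w else 0 := by
    rw [hw, e_smul_e_smul]
    split_ifs with h <;> simp [h]
  have hwc (c) : opGen k (.ar c) • w = 0 := by
    rw [hw, ar_smul_e_smul, hx, ite_self]
  let ι : SimpleS k j →ₗ[k] X := LinearMap.toSpanSingleton k X w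
  let p : X →ₗ[k] SimpleS k j := φ ∘ₗ Algebra.lsmul k k X (opGen k (.e j))
  refine ⟨j, linearMapOfGen ι ?_, linearMapOfGen p ?_, ?_⟩
  · have hι (g : QGen) (s : SimpleS k j) :
        opGen k g • ι s = LinearMap.toSpanSingleton k X (opGen k g • w) s :=
      opGen_smul_smul g _ w
    rintro (i | c) s
    · rw [e_smul_simpleS, hι, hwe]
      split_ifs
      · rfl
      · rw [map_zero, LinearMap.toSpanSingleton_zero]; rfl
    · rw [ar_smul_simpleS, hι, hwc, map_zero, LinearMap.toSpanSingleton_zero]; rfl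
  · have hp (y : X) : p y = φ (opGen k (.e j) • y) := rfl
    rintro (i | c) y
    · rw [e_smul_simpleS, hp, hp, e_smul_e_smul]
      rcases eq_or_ne i j with rfl | h
      · rw [if_pos rfl]; exact (if_pos rfl).symm
      · rw [if_neg h.symm, map_zero]; exact (if_neg h).symm
    · rw [ar_smul_simpleS, hp, e_smul_ar_smul]
      split_ifs
      exacts [hφ' _ _, map_zero φ]
  · ext (s : k)
    change φ (opGen k (.e j) • s • w) = s
    rw [opGen_smul_smul, hwe, if_pos rfl, map_smul, hφw, smul_eq_mul, mul_one]

end Simple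

section Nonvanishing

variable {k : Type} [Field k]

lemma not_subsingleton_ext_dualA_simpleS (j : Fin 3) :
    ¬ Subsingleton (ExtA k (DualA k) (SimpleS k j) 1) := by
  intro h
  let π : (Fin 4 → Aop k) →ₗ[Aop k] DualA k := Fintype.linearCombination (Aop k) (arrowCoeff k)
  have hπsingle (c) : π (Pi.single c 1) = arrowCoeff k c := by
    simp only [π, Fintype.linearCombination_apply_single, one_smul]
  have hπ : Function.Surjective π := by
    rw [← LinearMap.range_eq_top, ← Submodule.ker_mkQ (LinearMap.range π), LinearMap.ker_eq_top]
    refine dualA_hom_ext fun c ↦ ?_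
    rw [LinearMap.zero_apply, Submodule.mkQ_apply, Submodule.Quotient.mk_eq_zero]
    exact ⟨_, hπsingle c⟩
  have hker (a : LinearMap.ker π) (d) : vertexCoeff k (arrowSrc d) (a.1 d).unop = 0 := by
    have h : (∑ c, a.1 c • arrowCoeff k c) (gen k (.ar d)) = 0 := by
      have ha : ∑ c, a.1 c • arrowCoeff k c = 0 := a.2
      rw [ha]; rfl
    rw [LinearMap.sum_apply] at h
    simpa only [dualA_smul_apply, arrowCoeff_mul, arrowCoeff_gen_ar, vertexCoeff_gen_ar, mul_zero,
      add_zero, mul_ite, mul_one, Finset.sum_ite_eq', Finset.mem_univ, if_true] using h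
  obtain ⟨c, d, y, hsrc, rfl, hyc, hy⟩ : ∃ (c d : Fin 4) (y : Fin 4 → Aop k),
      arrowSrc d = arrowSrc c ∧ arrowTgt d = j ∧ y c = 0 ∧
      opGen k (.ar d) • arrowCoeff k c = opGen k (.ar 3) • π y := by
    fin_cases j
    · refine ⟨2, 1, 0, rfl, rfl, rfl, ?_⟩
      rw [ar_smul_arrowCoeff, map_zero, smul_zero]; rfl
    · refine ⟨0, 0, Pi.single 3 1, rfl, rfl, rfl, ?_⟩
      rw [hπsingle, ar_smul_arrowCoeff, ar_smul_arrowCoeff]; rfl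
    · refine ⟨1, 2, 0, rfl, rfl, rfl, ?_⟩
      rw [ar_smul_arrowCoeff, map_zero, smul_zero]; rfl
  let f : LinearMap.ker π →ₗ[Aop k] SimpleS k (arrowTgt d) :=
    { toFun a := arrowCoeff k d (a.1 c).unop
      map_add' a b := map_add (arrowCoeff k d) (a.1 c).unop (b.1 c).unop
      map_smul' m a := by
        refine (arrowCoeff_mul d (a.1 c).unop m.unop).trans ?_
        rw [hsrc, hker a c, zero_mul, zero_add, mul_comm]
        rfl }
  obtain ⟨g, hg⟩ := exists_extend_of_subsingleton_ext h π hπ f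
  let κ : LinearMap.ker π :=
    ⟨opGen k (.ar d) • Pi.single c 1 - opGen k (.ar 3) • y, by
      rw [LinearMap.mem_ker, map_sub, map_smul, map_smul, hπsingle, hy, sub_self]⟩
  have h0 : f κ = 0 := by
    rw [← hg κ, map_sub, map_smul, map_smul, ar_smul_simpleS, ar_smul_simpleS, sub_self]
  have h1 : f κ = arrowCoeff k d (gen k (.ar d)) := by
    have : κ.1 c = opGen k (.ar d) := by simp [κ, hyc]
    change arrowCoeff k d (κ.1 c).unop = _
    rw [this]; rfl
  rw [arrowCoeff_gen_ar, if_pos rfl] at h1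
  exact one_ne_zero (α := k) (h1.symm.trans h0)

lemma gen_ar_mul (b : Fin 4) (m : AlgA k) :
    gen k (.ar b) * m = vertexCoeff k (arrowTgt b) m • gen k (.ar b) := by
  have h : LinearMap.mulLeft k (gen k (.ar b)) =
      (vertexCoeff k (arrowTgt b)).smulRight (gen k (.ar b)) := by
    apply linearMap_ext_gen
    rintro (i | c) <;> simp [gen_ar_mul_gen_e, gen_ar_mul_gen_ar]
  exact congr($h m)

lemma not_subsingleton_ext_simpleS_algA (j : Fin 3) :
    ¬ Subsingleton (ExtA k (SimpleS k j) (AlgA k) 1) := by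
  intro h
  let π : Aop k →ₗ[Aop k] SimpleS k j :=
    { toFun a := vertexCoeff k j a.unop
      map_add' a b := map_add (vertexCoeff k j) a.unop b.unop
      map_smul' m a := (vertexCoeff_mul j a.unop m.unop).trans (mul_comm _ _) }
  have hπ : Function.Surjective π := fun (s : k) ↦ ⟨MulOpposite.op (s • gen k (.e j)), by
    change vertexCoeff k j (s • gen k (.e j)) = s
    simp⟩
  obtain ⟨d, b, rfl, htgt, hdb⟩ : ∃ d b : Fin 4, arrowSrc d = j ∧ arrowTgt d = arrowTgt b ∧
      (b = d → ∃ c, c ≠ d ∧ arrowSrc c = arrowSrc d) := by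
    fin_cases j
    exacts [⟨0, 3, rfl, rfl, by decide⟩, ⟨1, 1, rfl, rfl, by decide⟩, ⟨3, 0, rfl, rfl, by decide⟩]
  let f : LinearMap.ker π →ₗ[Aop k] AlgA k :=
    { toFun a := arrowCoeff k d a.1.unop • gen k (.ar b)
      map_add' a a' := by simp [add_smul]
      map_smul' m a := by
        have ha : vertexCoeff k (arrowSrc d) a.1.unop = 0 := a.2
        change arrowCoeff k d (a.1.unop * m.unop) • gen k (.ar b) =
          (arrowCoeff k d a.1.unop • gen k (.ar b)) * m.unop
        rw [arrowCoeff_mul, ha, zero_mul, zero_add, smul_mul_assoc, gen_ar_mul, smul_smul, htgt] }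
  obtain ⟨g, hg⟩ := exists_extend_of_subsingleton_ext h π hπ f
  have hg' (c) : g 1 * gen k (.ar c) = arrowCoeff k d (gen k (.ar c)) • gen k (.ar b) := by
    have h1 : g (opGen k (.ar c)) = g 1 * gen k (.ar c) := by
      conv_lhs => rw [← mul_one (opGen k (.ar c)), ← smul_eq_mul, map_smul]
      rfl
    rw [← h1]
    exact hg ⟨opGen k (.ar c), vertexCoeff_gen_ar k _ c⟩
  have hd := congr(arrowCoeff k b $(hg' d))
  by_cases hbd : b = d
  · obtain ⟨c, hcd, hc⟩ := hdb hbd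
    have hc' := congr(arrowCoeff k c $(hg' c))
    subst hbd
    simp [arrowCoeff_mul] at hd
    simp [arrowCoeff_mul, hcd.symm, hc, hd] at hc'
  · simp [arrowCoeff_mul, hbd] at hd

/-- If `Ext¹(M, X) = 0`, then the socle of `X` is contained in its radical. -/
lemma SocleLeRadical.of_subsingleton_ext_left {X : Type} [AddCommGroup X] [Module (Aop k) X]
    (h : Subsingleton (ExtA k (MA k) X 1)) : SocleLeRadical k X := by
  by_contra hX
  obtain ⟨j, ι, p, hp⟩ := exists_simple_retract hX
  exact not_subsingleton_ext_dualA_simpleS j (subsingleton_ext_of_retract h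
    (LinearMap.inr _ _ _) (LinearMap.snd _ _ _) (LinearMap.snd_comp_inr _ _ _) ι p hp)

/-- If `Ext¹(X, M) = 0`, then the socle of `X` is contained in its radical. -/
lemma SocleLeRadical.of_subsingleton_ext_right {X : Type} [AddCommGroup X] [Module (Aop k) X]
    (h : Subsingleton (ExtA k X (MA k) 1)) : SocleLeRadical k X := by
  by_contra hX
  obtain ⟨j, ι, p, hp⟩ := exists_simple_retract hX
  exact not_subsingleton_ext_simpleS_algA j (subsingleton_ext_of_retract h ι p hp
    (LinearMap.inl _ _ _) (LinearMap.fst _ _ _) (LinearMap.fst_comp_inl _ _ _))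

end Nonvanishing

section Decomposition

variable {k : Type} [Field k]

/-- The map into `D(A)` corresponding to a `k`-linear functional on `X`. -/
noncomputable def toDualA {X : Type*} [AddCommGroup X] [Module (Aop k) X] [Module k X]
    [IsScalarTower k (Aop k) X] (φ : X →ₗ[k] k) : X →ₗ[Aop k] DualA k where
  toFun x := φ ∘ₗ (LinearMap.toSpanSingleton (Aop k) X x).restrictScalars k ∘ₗ
    (MulOpposite.opLinearEquiv k).toLinearMap
  map_add' x y := by ext a; simp
  map_smul' m x := by
    ext a
    rw [RingHom.id_apply, dualA_smul_apply]
    simp [mul_smul]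

lemma toDualA_apply {X : Type*} [AddCommGroup X] [Module (Aop k) X] [Module k X]
    [IsScalarTower k (Aop k) X] (φ : X →ₗ[k] k) (x : X) (g : QGen) :
    toDualA φ x (gen k g) = φ (opGen k g • x) := rfl

lemma arrowSrc_ne_arrowTgt (c : Fin 4) : arrowSrc c ≠ arrowTgt c := by
  fin_cases c <;> decide

/-- An element of the socle lying in the image of each arrow into its vertex, independently,
splits off an injective summand. -/
lemma exists_injective_summand {X : Type} [AddCommGroup X] [Module (Aop k) X] {j : Fin 3} {w : X}
    (hw : opGen k (.e j) • w = w) (hw0 : w ≠ 0)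
    (hy : ∀ c, arrowTgt c = j → ∃ y, ∀ d, opGen k (.ar d) • y = if d = c then w else 0) :
    ∃ (q : X →ₗ[Aop k] DualA k) (p : DualA k →ₗ[Aop k] X),
      (∀ x, p (q (p (q x))) = p (q x)) ∧ ∃ x ≠ 0, p (q x) = x := by
  let _ := baseModule k X
  have : IsScalarTower k (Aop k) X := .of_algebraMap_smul fun _ _ ↦ rfl
  have hwe (i : Fin 3) : opGen k (.e i) • w = if i = j then w else 0 := by
    rw [← hw, e_smul_e_smul]
    split_ifs with h <;> simp [h, hw]
  have hwc (c) : opGen k (.ar c) • w = 0 := by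
    obtain ⟨d, hd⟩ : ∃ d, arrowTgt d = j := by
      fin_cases j
      exacts [⟨1, rfl⟩, ⟨0, rfl⟩, ⟨2, rfl⟩]
    obtain ⟨y, hy⟩ := hy d hd
    rw [← (hy d).trans (if_pos rfl), ar_smul_ar_smul]
  have hx (c) : ∃ x : X, (∀ i, opGen k (.e i) • x = if i = arrowSrc c then x else 0) ∧
      (∀ d, opGen k (.ar d) • x = if d = c ∧ arrowTgt c = j then w else 0) ∧
      (arrowTgt c ≠ j → x = 0) := by
    by_cases hc : arrowTgt c = j
    · obtain ⟨y, hy⟩ := hy c hc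
      refine ⟨opGen k (.e (arrowSrc c)) • y, fun i ↦ ?_, fun d ↦ ?_, fun h ↦ (h hc).elim⟩
      · rw [e_smul_e_smul]
        split_ifs with h <;> simp [h]
      · rw [ar_smul_e_smul, hy]
        grind
    · exact ⟨0, by simp, by simp [hc], fun _ ↦ rfl⟩
  choose x hxe hxc hx0 using hx
  obtain ⟨φ, hφ⟩ : ∃ φ : X →ₗ[k] k, φ w = 1 := by
    obtain ⟨φ, hφ⟩ := Module.Projective.exists_dual_ne_zero k hw0
    exact ⟨(φ w)⁻¹ • φ, by simp [hφ]⟩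
  let p : DualA k →ₗ[Aop k] X := dualALift (Pi.single j w) x
    (fun a b ↦ by
      rcases eq_or_ne b j with rfl | h
      · simp [hwe]
      · simp [h])
    (fun c b ↦ by
      rcases eq_or_ne b j with rfl | h
      · simp [hwc]
      · simp [h])
    (fun i c ↦ hxe c i) (fun c d ↦ by
      rw [hxc, Pi.single_apply]
      split_ifs <;> simp_all)
  have he (v) : p (toDualA φ v) =
      φ (opGen k (.e j) • v) • w + ∑ c, φ (opGen k (.ar c) • v) • x c := by
    simp [p, dualALift_apply, toDualA_apply, Pi.single_apply]
  have hew : p (toDualA φ w) = w := by simp [he, hw, hφ, hwc]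
  have hex (c) : p (toDualA φ (x c)) = x c := by
    rcases eq_or_ne (arrowTgt c) j with rfl | h
    · simp [he, hxe, hxc, (arrowSrc_ne_arrowTgt c).symm, apply_ite φ, hφ]
    · simp [hx0 c h]
  refine ⟨toDualA φ, p, fun v ↦ ?_, w, hw0, hew⟩
  rw [he v]
  simp only [map_add, map_sum, LinearMap.map_smul_of_tower, hew, hex]

lemma exists_functional_comp_eq {V W : Type*} [AddCommGroup V] [Module k V] [AddCommGroup W]
    [Module k W] (T : V →ₗ[k] W) (N : Submodule k W) (f : V →ₗ[k] k)
    (h : ∀ v, T v ∈ N → f v = 0) :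
    ∃ g : W →ₗ[k] k, (∀ v, g (T v) = f v) ∧ ∀ n ∈ N, g n = 0 := by
  have hf : f ∈ LinearMap.range (N.mkQ ∘ₗ T).dualMap := by
    rw [LinearMap.range_dualMap_eq_dualAnnihilator_ker, Submodule.mem_dualAnnihilator]
    intro v hv
    exact h v ((Submodule.Quotient.mk_eq_zero N).1 hv)
  obtain ⟨g, rfl⟩ := hf
  exact ⟨g ∘ₗ N.mkQ, fun v ↦ rfl, fun n hn ↦ by
    simp [(Submodule.Quotient.mk_eq_zero N).2 hn]⟩

/-- If no injective summand splits off, then the images of the arrows are independent. -/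
lemma ar_sum_eq_zero {X : Type*} [AddCommGroup X] [Module (Aop k) X]
    (hX : ∀ (j : Fin 3) (w : X), opGen k (.e j) • w = w →
      (∀ c, arrowTgt c = j → ∃ y, ∀ d, opGen k (.ar d) • y = if d = c then w else 0) → w = 0)
    {c : Fin 4} {v : X} {z : Fin 4 → X}
    (hz : ∑ d ∈ Finset.univ.erase c, opGen k (.ar d) • z d = opGen k (.ar c) • v) :
    opGen k (.ar c) • v = 0 := by
  have hw : opGen k (.e (arrowTgt c)) • opGen k (.ar c) • v = opGen k (.ar c) • v := by
    rw [e_smul_ar_smul, if_pos rfl]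
  have hwz : opGen k (.ar c) • v = ∑ d ∈ Finset.univ.erase c,
      if arrowTgt c = arrowTgt d then opGen k (.ar d) • z d else 0 := by
    rw [← hw, ← hz]
    simp only [Finset.smul_sum, e_smul_ar_smul]
  by_cases hc : ∀ d, arrowTgt c = arrowTgt d → d = c
  · rw [hwz]
    exact Finset.sum_eq_zero fun d hd ↦ if_neg fun h ↦ (Finset.mem_erase.1 hd).1 (hc d h)
  refine hX _ _ hw fun c' hc' ↦ ?_
  by_cases hcc : c' = c
  · refine ⟨opGen k (.e (arrowSrc c)) • v, fun d ↦ ?_⟩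
    have h₁ : arrowSrc c = arrowSrc d ↔ d = c := by
      clear * - hc
      revert c d
      decide
    rw [ar_smul_e_smul, hcc]
    simp only [h₁]
    split_ifs with h
    · rw [h]
    · rfl
  · refine ⟨opGen k (.e (arrowSrc c')) • z c', fun d ↦ ?_⟩
    have h₁ : arrowSrc c' = arrowSrc d ↔ d = c' := by
      clear * - hc hcc hc'
      revert c c' d
      decide
    rw [ar_smul_e_smul, hwz, Finset.sum_eq_single c' ?_ ?_, if_pos hc'.symm]
    · simp only [h₁]
      split_ifs with h
      · rw [h]
      · rfl
    · intro b hb hbc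
      refine if_neg fun h ↦ ?_
      have hb := (Finset.mem_erase.1 hb).1
      clear * - hb hbc hcc hc' h
      revert hb hbc hcc hc' h
      revert b c' c
      decide
    · exact fun h ↦ (h (Finset.mem_erase.2 ⟨hcc, Finset.mem_univ _⟩)).elim

/-- If no injective summand splits off, then a vector not killed by all arrows generates a
projective summand. -/
lemma exists_projective_summand {X : Type} [AddCommGroup X] [Module (Aop k) X]
    (hX : ∀ (j : Fin 3) (w : X), opGen k (.e j) • w = w →
      (∀ c, arrowTgt c = j → ∃ y, ∀ d, opGen k (.ar d) • y = if d = c then w else 0) → w = 0)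
    {c₀ : Fin 4} {x₀ : X} (hx₀ : opGen k (.ar c₀) • x₀ ≠ 0) :
    ∃ (q : X →ₗ[Aop k] AlgA k) (p : AlgA k →ₗ[Aop k] X),
      (∀ x, p (q (p (q x))) = p (q x)) ∧ ∃ x ≠ 0, p (q x) = x := by
  let _ := baseModule k X
  have : IsScalarTower k (Aop k) X := .of_algebraMap_smul fun _ _ ↦ rfl
  set i := arrowSrc c₀ with hi
  set u := opGen k (.e i) • x₀ with hu
  have hue (j : Fin 3) : opGen k (.e j) • u = if j = i then u else 0 := by
    rw [hu, e_smul_e_smul]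
    split_ifs with h <;> simp [h]
  have huc₀ : opGen k (.ar c₀) • u ≠ 0 := by rwa [hu, ar_smul_e_smul, if_pos hi.symm]
  have hu0 : u ≠ 0 := fun h ↦ huc₀ (by rw [h, smul_zero])
  -- a vector at the vertex `i` killed by one arrow is killed by all of them
  have hkill (c d : Fin 4) (hc : arrowSrc c = i) (y : X) (hy : opGen k (.e i) • y = y)
      (hcy : opGen k (.ar c) • y = 0) : opGen k (.ar d) • y = 0 := by
    by_cases hd : i = arrowSrc d
    swap
    · exact ar_smul_eq_zero_of_ne hy hd
    by_cases hcd : d = c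
    · rwa [hcd]
    refine hX (arrowTgt d) _ (by rw [e_smul_ar_smul, if_pos rfl]) fun c' hc' ↦ ⟨y, fun d' ↦ ?_⟩
    rw [hd] at hc
    have h₁ : c' = d := by
      clear * - hc hcd hc'
      revert c d c'
      decide
    subst h₁
    split_ifs with h
    · rw [h]
    · by_cases hd' : i = arrowSrc d'
      · have h₂ : d' = c := by
          rw [hd] at hd'
          clear * - hc hcd hd' h
          revert c c' d'
          decide
        rwa [h₂]
      · exact ar_smul_eq_zero_of_ne hy hd'
  let V : Submodule k X :=
    ⨅ c, LinearMap.ker (Algebra.lsmul k k X (opGen k (.ar c) * opGen k (.e i)))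
  have hV (v : X) : v ∈ V ↔ ∀ c, opGen k (.ar c) • opGen k (.e i) • v = 0 := by
    simp [V]
  have huV : u ∉ V := fun h ↦ huc₀ (by simpa [hue] using (hV u).1 h c₀)
  obtain ⟨f, hfu, hfV⟩ : ∃ f : X →ₗ[k] k, f u = 1 ∧ ∀ v ∈ V, f v = 0 := by
    obtain ⟨f, hfu, hf⟩ := Submodule.exists_le_ker_of_notMem huV
    exact ⟨(f u)⁻¹ • f, by simp [hfu], fun v hv ↦ by
      rw [LinearMap.smul_apply, LinearMap.mem_ker.1 (hf hv), smul_zero]⟩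
  have hfe (j v) : f (opGen k (.e j) • v) = if j = i then f v else 0 := by
    split_ifs with h
    · rw [← sub_eq_zero, ← map_sub]
      refine hfV _ ((hV _).2 fun c ↦ ?_)
      rw [smul_sub, e_smul_e_smul, h, if_pos rfl, sub_self, smul_zero]
    · refine hfV _ ((hV _).2 fun c ↦ ?_)
      rw [e_smul_e_smul, if_neg (Ne.symm h), smul_zero]
  have hfc (c v) : f (opGen k (.ar c) • v) = 0 := by
    refine hfV _ ((hV _).2 fun d ↦ ?_)
    rw [e_smul_ar_smul]
    split_ifs
    exacts [ar_smul_ar_smul _ _ _, smul_zero _]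
  have hg (c) : ∃ g : X →ₗ[k] k,
      (∀ d v, g (opGen k (.ar d) • v) = if d = c ∧ arrowSrc c = i then f v else 0) ∧
      (∀ j v, g (opGen k (.e j) • v) = if j = arrowTgt c then g v else 0) ∧
      (arrowSrc c ≠ i → g = 0) := by
    by_cases hc : arrowSrc c = i
    swap
    · exact ⟨0, by simp [hc], by simp, fun _ ↦ rfl⟩
    let N : Submodule k X := LinearMap.range
      (∑ d ∈ Finset.univ.erase c, Algebra.lsmul k k X (opGen k (.ar d)) ∘ₗ LinearMap.proj d)
    obtain ⟨g, hg₁, hg₂⟩ := exists_functional_comp_eq (Algebra.lsmul k k X (opGen k (.ar c))) N f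
      fun v hv ↦ by
        obtain ⟨z, hz⟩ : ∃ z : Fin 4 → X,
            ∑ d ∈ Finset.univ.erase c, opGen k (.ar d) • z d = opGen k (.ar c) • v := by
          obtain ⟨z, hz⟩ := hv
          exact ⟨z, by simpa using hz⟩
        have hw := ar_sum_eq_zero hX hz
        have hiv : opGen k (.e i) • opGen k (.e i) • v = opGen k (.e i) • v := by
          rw [e_smul_e_smul, if_pos rfl]
        have hfv := hfe i v
        rw [if_pos rfl] at hfv
        rw [← hfv]
        refine hfV _ ((hV _).2 fun d ↦ ?_)
        rw [hiv]
        exact hkill c d hc _ hiv (by rw [ar_smul_e_smul, if_pos hc.symm, hw])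
    refine ⟨g ∘ₗ Algebra.lsmul k k X (opGen k (.e (arrowTgt c))), fun d v ↦ ?_, fun j v ↦ ?_,
      fun h ↦ (h hc).elim⟩
    · change g (opGen k (.e (arrowTgt c)) • opGen k (.ar d) • v) = _
      rw [e_smul_ar_smul]
      by_cases hd : d = c
      · rw [hd, if_pos rfl, if_pos ⟨rfl, hc⟩]
        exact hg₁ v
      · rw [if_neg (c := d = c ∧ _) (fun h ↦ hd h.1)]
        split_ifs
        · refine hg₂ _ ⟨Pi.single d v, ?_⟩
          simp only [LinearMap.sum_apply, LinearMap.comp_apply, LinearMap.proj_apply]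
          rw [Finset.sum_eq_single d (fun b _ hb ↦ by rw [Pi.single_eq_of_ne hb, map_zero])
            (fun h ↦ (h (Finset.mem_erase.2 ⟨hd, Finset.mem_univ d⟩)).elim), Pi.single_eq_same]
          rfl
        · exact map_zero g
    · change g (opGen k (.e (arrowTgt c)) • opGen k (.e j) • v) = _
      rw [e_smul_e_smul]
      rcases eq_or_ne j (arrowTgt c) with rfl | h
      · rw [if_pos rfl, if_pos rfl]; rfl
      · rw [if_neg h, if_neg h.symm, map_zero]
  choose g hgc hge hg0 using hg
  let q : X →ₗ[Aop k] AlgA k := linearMapOfGen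
    (f.smulRight (gen k (.e i)) + ∑ c, (g c).smulRight (gen k (.ar c))) (by
      intro g' v
      change _ = _ * gen k g'
      rcases g' with j | d
      · simp only [LinearMap.add_apply, LinearMap.sum_apply, LinearMap.smulRight_apply, hfe, hge,
          add_mul, Finset.sum_mul, smul_mul_assoc, gen_e_mul_gen_e, gen_ar_mul_gen_e, ite_smul,
          smul_ite, zero_smul, smul_zero, eq_comm (a := j)]
      · simp only [LinearMap.add_apply, LinearMap.sum_apply, LinearMap.smulRight_apply, hfc, hgc,
          add_mul, Finset.sum_mul, smul_mul_assoc, gen_e_mul_gen_ar, gen_ar_mul_gen_ar, ite_smul,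
          smul_ite, zero_smul, smul_zero]
        rw [Finset.sum_eq_single d (fun c _ hc ↦ if_neg fun h ↦ hc h.1.symm) (by simp)]
        simp [eq_comm (a := i)])
  let p : AlgA k →ₗ[Aop k] X :=
    LinearMap.toSpanSingleton (Aop k) X u ∘ₗ (algAEquiv k).symm.toLinearMap
  have hp (g) : p (gen k g) = opGen k g • u := rfl
  have he (v) : p (q v) = f v • u + ∑ c, g c v • opGen k (.ar c) • u := by
    simp [q, hp, hue]
  have heu : p (q u) = u := by
    rw [he, hfu, one_smul, add_eq_left]
    refine Finset.sum_eq_zero fun c _ ↦ ?_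
    by_cases hc : arrowSrc c = i
    · have h := hge c i u
      rw [hue, if_pos rfl, ← hc, if_neg (arrowSrc_ne_arrowTgt c)] at h
      rw [h, zero_smul]
    · rw [hg0 c hc, LinearMap.zero_apply, zero_smul]
  refine ⟨q, p, fun v ↦ ?_, u, hu0, heu⟩
  rw [he v]
  simp only [map_add, map_sum, LinearMap.map_smul_of_tower, heu]

end Decomposition

section Additive

variable {k : Type} [Field k]

lemma SocleLeRadical.exists_summand {X : Type} [AddCommGroup X] [Module (Aop k) X]
    [Nontrivial X] (hX : SocleLeRadical k X) :
    ∃ (q : X →ₗ[Aop k] MA k) (p : MA k →ₗ[Aop k] X),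
      (∀ x, p (q (p (q x))) = p (q x)) ∧ ∃ x ≠ 0, p (q x) = x := by
  by_cases h : ∀ (j : Fin 3) (w : X), opGen k (.e j) • w = w →
      (∀ c, arrowTgt c = j → ∃ y, ∀ d, opGen k (.ar d) • y = if d = c then w else 0) → w = 0
  · obtain ⟨c, x, hx⟩ : ∃ (c : Fin 4) (x : X), opGen k (.ar c) • x ≠ 0 := by
      by_contra! hx
      obtain ⟨x, hx0⟩ := exists_ne (0 : X)
      obtain ⟨u, rfl⟩ := hX x fun c ↦ hx c x
      exact hx0 (Finset.sum_eq_zero fun c _ ↦ hx c _)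
    obtain ⟨q, p, hqp⟩ := exists_projective_summand h hx
    exact ⟨LinearMap.inl _ _ _ ∘ₗ q, p ∘ₗ LinearMap.fst _ _ _, hqp⟩
  · push Not at h
    obtain ⟨j, w, hw, hy, hw0⟩ := h
    obtain ⟨q, p, hqp⟩ := exists_injective_summand hw hw0 hy
    exact ⟨LinearMap.inr _ _ _ ∘ₗ q, p ∘ₗ LinearMap.snd _ _ _, hqp⟩

lemma InAdd.of_add_eq_id {M X K : Type} [AddCommGroup M] [Module (Aop k) M]
    [AddCommGroup X] [Module (Aop k) X] [AddCommGroup K] [Module (Aop k) K] (hK : InAdd k M K)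
    (q : X →ₗ[Aop k] M) (p : M →ₗ[Aop k] X) (r : X →ₗ[Aop k] K) (s : K →ₗ[Aop k] X)
    (h : p ∘ₗ q + s ∘ₗ r = LinearMap.id) : InAdd k M X := by
  obtain ⟨n, ι, π, hπ⟩ := hK
  refine ⟨n + 1, LinearMap.pi (Fin.cons q fun a ↦ LinearMap.proj a ∘ₗ ι ∘ₗ r),
    p ∘ₗ LinearMap.proj 0 + s ∘ₗ π ∘ₗ LinearMap.funLeft _ _ Fin.succ, ?_⟩
  rw [← h]
  ext x
  have : π (ι (r x)) = r x := congr($hπ (r x))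
  change p (q x) + s (π (ι (r x))) = _
  rw [this]
  rfl

lemma SocleLeRadical.inAdd_MA {X : Type} [AddCommGroup X] [Module (Aop k) X] [Module k X]
    [IsScalarTower k (Aop k) X] [Module.Finite k X] (hX : SocleLeRadical k X) :
    InAdd k (MA k) X := by
  induction h : Module.finrank k X using Nat.strong_induction_on generalizing X with
  | _ n ih
  subst h
  rcases subsingleton_or_nontrivial X with hX' | hX'
  · exact ⟨0, 0, 0, LinearMap.ext fun x ↦ Subsingleton.elim _ _⟩
  obtain ⟨q, p, hqp, x, hx0, hx⟩ := hX.exists_summand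
  let K := LinearMap.ker (p ∘ₗ q)
  let r : X →ₗ[Aop k] K := (LinearMap.id - p ∘ₗ q).codRestrict K fun y ↦ by
    simp [K, hqp]
  have hr : r ∘ₗ K.subtype = LinearMap.id := by
    ext y
    simp [r]
  have : Module.Finite k K := inferInstanceAs (Module.Finite k (K.restrictScalars k))
  have hK : InAdd k (MA k) K := by
    refine ih _ ?_ (hX.of_comp_eq_id K.subtype r hr) rfl
    exact Submodule.finrank_lt (s := K.restrictScalars k) fun h ↦ hx0 <| by
      have : x ∈ K.restrictScalars k := h ▸ Submodule.mem_top
      exact hx.symm.trans this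
  refine hK.of_add_eq_id q p r K.subtype ?_
  ext y
  simp [r]

lemma SocleLeRadical.inAdd_MA_of_finite {X : Type} [AddCommGroup X] [Module (Aop k) X]
    [Module.Finite (Aop k) X] (hX : SocleLeRadical k X) : InAdd k (MA k) X := by
  let _ := baseModule k X
  have : IsScalarTower k (Aop k) X := .of_algebraMap_smul fun _ _ ↦ rfl
  have : Module.Finite k (Aop k) := .equiv (MulOpposite.opLinearEquiv k)
  have : Module.Finite k X := .trans (Aop k) X
  exact hX.inAdd_MA

lemma InAdd.socleLeRadical {X : Type} [AddCommGroup X] [Module (Aop k) X]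
    (hX : InAdd k (MA k) X) : SocleLeRadical k X := by
  obtain ⟨n, ι, π, h⟩ := hX
  exact socleLeRadical_MA.pi.of_comp_eq_id ι π h

end Additive

/-- The right `A`-module `M = A ⊕ D(A)` is a 2-cluster tilting module, i.e.
`add M = {X ∈ mod A | Ext¹_A(M,X) = 0} = {X ∈ mod A | Ext¹_A(X,M) = 0}`. -/
theorem ma_isTwoClusterTilting (k : Type) [Field k] :
    IsTwoClusterTilting k (MA k) := by
  refine ⟨fun X _ _ _ ↦ ⟨fun h ↦ h.socleLeRadical.mapsLift_MA.subsingleton_ext,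
    fun h ↦ (SocleLeRadical.of_subsingleton_ext_left h).inAdd_MA_of_finite⟩,
    fun X _ _ _ ↦ ⟨fun h ↦ ?_,
    fun h ↦ (SocleLeRadical.of_subsingleton_ext_right h).inAdd_MA_of_finite⟩⟩
  obtain ⟨n, ι, π, h⟩ := h
  exact (socleLeRadical_MA.mapsLift_MA.pi.of_comp_eq_id ι π h).subsingleton_ext
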